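/- Let T₁, T₂ : ℋⁿ → ℋⁿ be ℝ-linear maps with least vectors q₁ and q₂ respectively, and let q be the least vector of the sum T₁ + T₂. Then q ≺_w q₁ + q₂. -/

import Mathlib

open Matrix
open scoped ComplexOrder

/-- Sum of the `k` largest entries of `p` (as a supremum of sums over `k`-subsets). -/
noncomputable def sumLargest {n : ℕ} (p : Fin n → ℝ) (k : ℕ) : ℝ :=
  sSup ((fun A : Finset (Fin n) => ∑ i ∈ A, p i) '' {A : Finset (Fin n) | A.card = k})

/-- `p` is weakly majorized by `q`. -/
def WeakMaj {n : ℕ} (p q : Fin n → ℝ) : Prop :=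
  ∀ k : ℕ, 1 ≤ k → k ≤ n → sumLargest p k ≤ sumLargest q k

/-- `p` is majorized by `q`. -/
def Maj {n : ℕ} (p q : Fin n → ℝ) : Prop :=
  WeakMaj p q ∧ ∑ i, p i = ∑ i, q i

/-- `p` has nonnegative entries arranged in decreasing order. -/
def DecrNonneg {n : ℕ} (p : Fin n → ℝ) : Prop :=
  Antitone p ∧ ∀ i, 0 ≤ p i

/-- The decreasing rearrangement of a vector. -/
noncomputable def decrRearrange {n : ℕ} (p : Fin n → ℝ) : Fin n → ℝ :=
  fun i => p (Tuple.sort p (Fin.rev i))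

/-- `x` is the supremum of `S` in the weak-majorization order (w-sup). -/
def IsWSup {n : ℕ} (S : Set (Fin n → ℝ)) (x : Fin n → ℝ) : Prop :=
  DecrNonneg x ∧ (∀ s ∈ S, WeakMaj s x) ∧
    ∀ p : Fin n → ℝ, (∀ i, 0 ≤ p i) → (∀ s ∈ S, WeakMaj s p) → WeakMaj x p

/-- `x` is the infimum of `Q` in the weak-majorization order (w-inf). -/
def IsWInf {n : ℕ} (Q : Set (Fin n → ℝ)) (x : Fin n → ℝ) : Prop :=
  DecrNonneg x ∧ (∀ q ∈ Q, WeakMaj x q) ∧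
    ∀ p : Fin n → ℝ, (∀ i, 0 ≤ p i) → (∀ q ∈ Q, WeakMaj p q) → WeakMaj p x

open Classical in
/-- The vector of eigenvalues of a Hermitian matrix, in decreasing order
(junk value `0` if the matrix is not Hermitian). -/
noncomputable def specVec {n : ℕ} (X : Matrix (Fin n) (Fin n) ℂ) : Fin n → ℝ :=
  if h : X.IsHermitian then decrRearrange h.eigenvalues else 0

open Classical in
/-- `λ(|X|)`: the absolute values of the eigenvalues of a Hermitian matrix `X`,
in decreasing order. -/
noncomputable def absSpecVec {n : ℕ} (X : Matrix (Fin n) (Fin n) ℂ) : Fin n → ℝ :=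
  if h : X.IsHermitian then decrRearrange (fun i => |h.eigenvalues i|) else 0

/-- The Jordan product `X ∘ Y = (XY + YX)/2`. -/
noncomputable def jmul {n : ℕ} (X Y : Matrix (Fin n) (Fin n) ℂ) : Matrix (Fin n) (Fin n) ℂ :=
  (2 : ℂ)⁻¹ • (X * Y + Y * X)

/-- A nonzero (orthogonal) projection in `ℋⁿ`. -/
def IsProjection {n : ℕ} (P : Matrix (Fin n) (Fin n) ℂ) : Prop :=
  P.IsHermitian ∧ P * P = P ∧ P ≠ 0

/-- An involution in `ℋⁿ`: a Hermitian matrix with `ε² = I`. -/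
def IsInvolution {n : ℕ} (ε : Matrix (Fin n) (Fin n) ℂ) : Prop :=
  ε.IsHermitian ∧ ε * ε = 1

/-- A positive map: maps positive semidefinite matrices to positive semidefinite matrices. -/
def PositiveMap {n : ℕ} (T : Matrix (Fin n) (Fin n) ℂ → Matrix (Fin n) (Fin n) ℂ) : Prop :=
  ∀ X : Matrix (Fin n) (Fin n) ℂ, X.PosSemidef → (T X).PosSemidef

/-- `S` is the adjoint of `T` with respect to the trace inner product on `ℋⁿ`. -/
def IsAdjointOf {n : ℕ} (S T : Matrix (Fin n) (Fin n) ℂ → Matrix (Fin n) (Fin n) ℂ) : Prop :=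
  ∀ X Y : Matrix (Fin n) (Fin n) ℂ, X.IsHermitian → Y.IsHermitian →
    Matrix.trace (T X * Y) = Matrix.trace (X * S Y)

/-- `q` is the least vector of `T`: `λ(|T(X)|) ≺_w q * λ(|X|)` for all Hermitian `X`,
and `q ≺_w q'` for any other `q' ∈ (ℝⁿ₊)↓` with the same property. -/
def IsLeastVector {n : ℕ} (T : Matrix (Fin n) (Fin n) ℂ → Matrix (Fin n) (Fin n) ℂ)
    (q : Fin n → ℝ) : Prop :=
  DecrNonneg q ∧
  (∀ X : Matrix (Fin n) (Fin n) ℂ, X.IsHermitian →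
    WeakMaj (absSpecVec (T X)) (q * absSpecVec X)) ∧
  ∀ q' : Fin n → ℝ, DecrNonneg q' →
    (∀ X : Matrix (Fin n) (Fin n) ℂ, X.IsHermitian →
      WeakMaj (absSpecVec (T X)) (q' * absSpecVec X)) → WeakMaj q q'

theorem sum_le_sumLargest {n : ℕ} (p : Fin n → ℝ) (A : Finset (Fin n)) :
    ∑ i ∈ A, p i ≤ sumLargest p A.card :=
  le_csSup (Set.toFinite _).bddAbove ⟨A, rfl, rfl⟩

theorem sumLargest_le {n : ℕ} {p : Fin n → ℝ} {k : ℕ} {c : ℝ} (hk : k ≤ n)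
    (h : ∀ A : Finset (Fin n), A.card = k → ∑ i ∈ A, p i ≤ c) : sumLargest p k ≤ c := by
  refine csSup_le ?_ ?_
  · obtain ⟨A, -, hA⟩ := Finset.exists_subset_card_eq (s := (Finset.univ : Finset (Fin n)))
      (n := k) (by simpa using hk)
    exact ⟨_, A, hA, rfl⟩
  · rintro _ ⟨A, hA, rfl⟩
    exact h A hA

theorem sumLargest_comp_perm {n : ℕ} (p : Fin n → ℝ) (σ : Equiv.Perm (Fin n)) {k : ℕ}
    (hk : k ≤ n) : sumLargest (p ∘ σ) k = sumLargest p k := by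
  have key : ∀ (r : Fin n → ℝ) (τ : Equiv.Perm (Fin n)),
      sumLargest (r ∘ τ) k ≤ sumLargest r k := by
    intro r τ
    refine sumLargest_le hk fun A hA => ?_
    have h := sum_le_sumLargest r (A.map τ.toEmbedding)
    rw [Finset.card_map, hA] at h
    simpa using h
  refine le_antisymm (key p σ) ?_
  have h := key (p ∘ σ) σ.symm
  simpa [Function.comp_assoc] using h

theorem exists_decrRearrange_eq_comp {n : ℕ} (p : Fin n → ℝ) :
    ∃ σ : Equiv.Perm (Fin n), decrRearrange p = p ∘ σ :=
  ⟨Fin.revPerm.trans (Tuple.sort p), rfl⟩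

theorem antitone_decrRearrange {n : ℕ} (p : Fin n → ℝ) : Antitone (decrRearrange p) :=
  fun _ _ h => Tuple.monotone_sort p (Fin.rev_le_rev.mpr h)

theorem card_filter_val_lt {n k : ℕ} (hk : k ≤ n) :
    (Finset.univ.filter fun i : Fin n => (i : ℕ) < k).card = k := by
  rw [Fin.card_filter_val_lt, min_eq_right hk]

theorem Antitone.sum_mul_le {n k : ℕ} {p w : Fin n → ℝ} (hp : Antitone p) (hk₁ : 1 ≤ k)
    (hk : k ≤ n) (hw₀ : ∀ i, 0 ≤ w i) (hw₁ : ∀ i, w i ≤ 1) (hw : ∑ i, w i = k) :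
    ∑ i, p i * w i ≤ ∑ i with i.val < k, p i := by
  set t := p ⟨k - 1, by omega⟩ with ht
  have hc : ∑ i : Fin n, (if (i : ℕ) < k then (1 : ℝ) else 0) = k := by
    rw [← Finset.sum_filter, Finset.sum_const, card_filter_val_lt hk]
    simp
  have h : ∀ i : Fin n, (p i - t) * w i ≤ (p i - t) * (if (i : ℕ) < k then 1 else 0) := by
    intro i
    split_ifs with hi
    · have : t ≤ p i := hp (Fin.le_def.mpr (by simp; omega))
      nlinarith [hw₁ i]
    · have : p i ≤ t := hp (Fin.le_def.mpr (by simp; omega))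
      nlinarith [hw₀ i]
  have hs := Finset.sum_le_sum fun i (_ : i ∈ Finset.univ) => h i
  simp only [sub_mul, Finset.sum_sub_distrib, ← Finset.mul_sum, hw, hc] at hs
  rw [Finset.sum_filter]
  simpa using hs

theorem Antitone.sumLargest_eq {n k : ℕ} {p : Fin n → ℝ} (hp : Antitone p) (hk₁ : 1 ≤ k)
    (hk : k ≤ n) : sumLargest p k = ∑ i with i.val < k, p i := by
  refine le_antisymm (sumLargest_le hk fun A hA => ?_) ?_
  · have h := hp.sum_mul_le (w := fun i => if i ∈ A then 1 else 0) hk₁ hk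
      (fun i => by split_ifs <;> norm_num) (fun i => by split_ifs <;> norm_num) (by simp [hA])
    simpa using h
  · have h := sum_le_sumLargest p (Finset.univ.filter fun i : Fin n => (i : ℕ) < k)
    rwa [card_filter_val_lt hk] at h

theorem sum_mul_le_sumLargest {n k : ℕ} (p : Fin n → ℝ) {w : Fin n → ℝ} (hk₁ : 1 ≤ k)
    (hk : k ≤ n) (hw₀ : ∀ i, 0 ≤ w i) (hw₁ : ∀ i, w i ≤ 1) (hw : ∑ i, w i = k) :
    ∑ i, p i * w i ≤ sumLargest p k := by
  obtain ⟨σ, hσ⟩ := exists_decrRearrange_eq_comp p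
  have hanti := antitone_decrRearrange p
  rw [hσ] at hanti
  rw [← sumLargest_comp_perm p σ hk, hanti.sumLargest_eq hk₁ hk,
    ← Equiv.sum_comp σ fun i => p i * w i]
  exact hanti.sum_mul_le (w := w ∘ σ) hk₁ hk (fun _ => hw₀ _) (fun _ => hw₁ _)
    (by rw [← hw]; exact Equiv.sum_comp σ w)

theorem sumLargest_absSpecVec {n k : ℕ} {X : Matrix (Fin n) (Fin n) ℂ} (hX : X.IsHermitian)
    (hk : k ≤ n) : sumLargest (absSpecVec X) k = sumLargest (fun i => |hX.eigenvalues i|) k := by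
  obtain ⟨σ, hσ⟩ := exists_decrRearrange_eq_comp fun i => |hX.eigenvalues i|
  rw [absSpecVec, dif_pos hX, hσ, sumLargest_comp_perm _ _ hk]

theorem decrNonneg_absSpecVec {n : ℕ} {X : Matrix (Fin n) (Fin n) ℂ} (hX : X.IsHermitian) :
    DecrNonneg (absSpecVec X) := by
  rw [absSpecVec, dif_pos hX]
  exact ⟨antitone_decrRearrange _, fun i => abs_nonneg _⟩

theorem toEuclideanLin_eigenvectorBasis {n : ℕ} {X : Matrix (Fin n) (Fin n) ℂ}
    (hX : X.IsHermitian) (j : Fin n) :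
    X.toEuclideanLin (hX.eigenvectorBasis j) =
      (hX.eigenvalues j : ℂ) • hX.eigenvectorBasis j := by
  ext i
  simpa using congrFun (hX.mulVec_eigenvectorBasis j) i

theorem inner_toEuclideanLin_eq_sum {n : ℕ} {X : Matrix (Fin n) (Fin n) ℂ}
    (hX : X.IsHermitian) (u : EuclideanSpace ℂ (Fin n)) :
    inner ℂ u (X.toEuclideanLin u) =
      ((∑ j, hX.eigenvalues j * ‖inner ℂ (hX.eigenvectorBasis j) u‖ ^ 2 : ℝ) : ℂ) := by
  have hs : X.toEuclideanLin.IsSymmetric := Matrix.isSymmetric_toEuclideanLin_iff.mpr hX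
  rw [← hX.eigenvectorBasis.sum_inner_mul_inner, Complex.ofReal_sum]
  refine Finset.sum_congr rfl fun j _ => ?_
  rw [← hs, toEuclideanLin_eigenvectorBasis, inner_smul_left, ← inner_conj_symm u]
  push_cast
  rw [← Complex.conj_mul', Complex.conj_ofReal]
  ring

/-- One half of the Ky Fan variational principle for Hermitian matrices. -/
theorem sum_abs_inner_le_sumLargest {n : ℕ} {X : Matrix (Fin n) (Fin n) ℂ}
    (hX : X.IsHermitian) (u : OrthonormalBasis (Fin n) ℂ (EuclideanSpace ℂ (Fin n)))
    {A : Finset (Fin n)} (hA : 1 ≤ A.card) :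
    ∑ i ∈ A, ‖inner ℂ (u i) (X.toEuclideanLin (u i))‖ ≤ sumLargest (absSpecVec X) A.card := by
  have hn : A.card ≤ n := by simpa using A.card_le_univ
  rw [sumLargest_absSpecVec hX hn]
  set v := hX.eigenvectorBasis
  have hu : ∀ x : EuclideanSpace ℂ (Fin n), ‖x‖ = 1 → ∑ i, ‖inner ℂ x (u i)‖ ^ 2 = 1 := by
    intro x hx
    rw [u.sum_sq_norm_inner_left, hx, one_pow]
  have hv : ∀ x : EuclideanSpace ℂ (Fin n), ‖x‖ = 1 → ∑ j, ‖inner ℂ (v j) x‖ ^ 2 = 1 := by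
    intro x hx
    rw [v.sum_sq_norm_inner_right, hx, one_pow]
  calc ∑ i ∈ A, ‖inner ℂ (u i) (X.toEuclideanLin (u i))‖
      ≤ ∑ i ∈ A, ∑ j, |hX.eigenvalues j| * ‖inner ℂ (v j) (u i)‖ ^ 2 := by
        refine Finset.sum_le_sum fun i _ => ?_
        rw [inner_toEuclideanLin_eq_sum hX, Complex.norm_real, Real.norm_eq_abs]
        refine (Finset.abs_sum_le_sum_abs _ _).trans_eq ?_
        simp [abs_mul, v]
    _ = ∑ j, |hX.eigenvalues j| * ∑ i ∈ A, ‖inner ℂ (v j) (u i)‖ ^ 2 := by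
        rw [Finset.sum_comm]
        simp only [Finset.mul_sum]
    _ ≤ _ := by
        refine sum_mul_le_sumLargest _ hA hn (fun j => by positivity) (fun j => ?_) ?_
        · rw [← hu (v j) (v.norm_eq_one j)]
          exact Finset.sum_le_univ_sum_of_nonneg fun i => by positivity
        · rw [Finset.sum_comm, Finset.sum_congr rfl fun i _ => hv (u i) (u.norm_eq_one i)]
          simp

/-- Ky Fan's triangle inequality. -/
theorem sumLargest_absSpecVec_add_le {n k : ℕ} {X Y : Matrix (Fin n) (Fin n) ℂ}
    (hX : X.IsHermitian) (hY : Y.IsHermitian) (hk₁ : 1 ≤ k) (hk : k ≤ n) :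
    sumLargest (absSpecVec (X + Y)) k ≤
      sumLargest (absSpecVec X) k + sumLargest (absSpecVec Y) k := by
  have hXY := hX.add hY
  rw [sumLargest_absSpecVec hXY hk]
  refine sumLargest_le hk fun A hA => ?_
  subst hA
  set u := hXY.eigenvectorBasis
  refine le_trans ?_ (add_le_add (sum_abs_inner_le_sumLargest hX u hk₁)
    (sum_abs_inner_le_sumLargest hY u hk₁))
  rw [← Finset.sum_add_distrib]
  refine Finset.sum_le_sum fun i _ => ?_
  have h : inner ℂ (u i) ((X + Y).toEuclideanLin (u i)) = (hXY.eigenvalues i : ℂ) := by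
    rw [toEuclideanLin_eigenvectorBasis hXY, inner_smul_right, inner_self_eq_norm_sq_to_K,
      u.norm_eq_one]
    simp
  rw [← Real.norm_eq_abs, ← Complex.norm_real, ← h, map_add, LinearMap.add_apply, inner_add_right]
  exact norm_add_le _ _

theorem DecrNonneg.add {n : ℕ} {p q : Fin n → ℝ} (hp : DecrNonneg p) (hq : DecrNonneg q) :
    DecrNonneg (p + q) :=
  ⟨hp.1.add hq.1, fun i => add_nonneg (hp.2 i) (hq.2 i)⟩

theorem DecrNonneg.mul {n : ℕ} {p q : Fin n → ℝ} (hp : DecrNonneg p) (hq : DecrNonneg q) :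
    DecrNonneg (p * q) :=
  ⟨fun _ j h => mul_le_mul (hp.1 h) (hq.1 h) (hq.2 j) (hp.2 _),
    fun i => mul_nonneg (hp.2 i) (hq.2 i)⟩

theorem DecrNonneg.sumLargest_add {n k : ℕ} {p q : Fin n → ℝ} (hp : DecrNonneg p)
    (hq : DecrNonneg q) (hk₁ : 1 ≤ k) (hk : k ≤ n) :
    sumLargest (p + q) k = sumLargest p k + sumLargest q k := by
  rw [hp.1.sumLargest_eq hk₁ hk, hq.1.sumLargest_eq hk₁ hk, (hp.add hq).1.sumLargest_eq hk₁ hk,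
    ← Finset.sum_add_distrib]
  rfl

theorem least_vector_add (n : ℕ) (T₁ T₂ : Matrix (Fin n) (Fin n) ℂ → Matrix (Fin n) (Fin n) ℂ)
    (hT₁lin : IsLinearMap ℝ T₁) (hT₂lin : IsLinearMap ℝ T₂)
    (hT₁ : ∀ X : Matrix (Fin n) (Fin n) ℂ, X.IsHermitian → (T₁ X).IsHermitian)
    (hT₂ : ∀ X : Matrix (Fin n) (Fin n) ℂ, X.IsHermitian → (T₂ X).IsHermitian)
    (q₁ q₂ q : Fin n → ℝ)
    (hq₁ : IsLeastVector T₁ q₁) (hq₂ : IsLeastVector T₂ q₂)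
    (hq : IsLeastVector (fun X => T₁ X + T₂ X) q) :
    WeakMaj q (q₁ + q₂) := by
  refine hq.2.2 _ (hq₁.1.add hq₂.1) fun X hX k hk₁ hk => ?_
  have ha := decrNonneg_absSpecVec hX
  rw [add_mul, (hq₁.1.mul ha).sumLargest_add (hq₂.1.mul ha) hk₁ hk]
  exact (sumLargest_absSpecVec_add_le (hT₁ X hX) (hT₂ X hX) hk₁ hk).trans
    (add_le_add (hq₁.2.1 X hX k hk₁ hk) (hq₂.2.1 X hX k hk₁ hk))
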